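/- Let L0 be a closed densely defined symmetric positive definite operator in a complex Hilbert space H, and L a positive definite self-adjoint extension of L0 with bounded everywhere-defined inverse L⁻¹. Let D be a closed subspace of H such that D ⊆ (Ker L0*)ᗮ and L⁻¹ D ⊆ D. Then L⁻¹ D ⊆ Dom L0, and for every d ∈ D one has L0 (L⁻¹ d) = d; in particular L0 maps L⁻¹ D into D. -/

import Mathlib

local notation "⟪" x ", " y "⟫" => @inner ℂ _ _ x y

/-- The kernel of a partially defined linear operator, as a submodule of the ambient space. -/
def pker {H : Type*} [NormedAddCommGroup H] [InnerProductSpace ℂ H]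
    (T : H →ₗ.[ℂ] H) : Submodule ℂ H :=
  (LinearMap.ker T.toFun).map T.domain.subtype

/-- A vector orthogonal to the range of a densely defined operator lies in the kernel of its
adjoint. -/
theorem mem_pker_adjoint_of_inner_eq_zero {H : Type*} [NormedAddCommGroup H]
    [InnerProductSpace ℂ H] [CompleteSpace H] {T : H →ₗ.[ℂ] H}
    (hT : Dense (T.domain : Set H)) {y : H} (hy : ∀ u : T.domain, ⟪y, T u⟫ = 0) :
    y ∈ pker T.adjoint := by
  have hmem : y ∈ T.adjoint.domain :=
    T.mem_adjoint_domain_of_exists y ⟨0, fun u => by rw [inner_zero_left, hy u]⟩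
  refine Submodule.mem_map.mpr ⟨⟨y, hmem⟩, ?_, rfl⟩
  exact LinearPMap.adjoint_apply_eq hT ⟨y, hmem⟩ fun u => by rw [inner_zero_left, hy u]

/-- If a closed densely defined operator `T` has a bounded left inverse `S`, then every vector
`x` of `(Ker T*)ᗮ` is in the range of `T`, with `T (S x) = x`. -/
theorem mk_mem_graph_of_mem_pker_adjoint_orthogonal {H : Type*} [NormedAddCommGroup H]
    [InnerProductSpace ℂ H] [CompleteSpace H] {T : H →ₗ.[ℂ] H}
    (hT : Dense (T.domain : Set H)) (hclosed : T.IsClosed) (S : H →L[ℂ] H)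
    (hS : ∀ u : T.domain, S (T u) = u) {x : H} (hx : x ∈ (pker T.adjoint)ᗮ) :
    (S x, x) ∈ T.graph := by
  let R : Submodule ℂ H := T.graph.comap (S.prod (ContinuousLinearMap.id ℂ H)).toLinearMap
  have hR : IsClosed (R : Set H) :=
    hclosed.preimage (S.prod (ContinuousLinearMap.id ℂ H)).continuous
  have hrange : ∀ u : T.domain, T u ∈ R := fun u => by
    change (S (T u), T u) ∈ T.graph
    rw [hS u]
    exact T.mem_graph u
  have hle : Rᗮ ≤ pker T.adjoint := fun y hy =>
    mem_pker_adjoint_of_inner_eq_zero hT fun u =>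
      Submodule.inner_left_of_mem_orthogonal (hrange u) hy
  have hxR : x ∈ Rᗮᗮ := Submodule.orthogonal_le hle hx
  rw [Submodule.orthogonal_orthogonal_eq_closure, hR.submodule_topologicalClosure_eq] at hxR
  exact hxR

/-- On a closed subspace `D ⊆ (Ker L0*)ᗮ` invariant under `L⁻¹`, one has
`L⁻¹ D ⊆ Dom L0` and `L0 (L⁻¹ d) = d` for all `d ∈ D`. -/
theorem statement10 {H : Type*} [NormedAddCommGroup H] [InnerProductSpace ℂ H] [CompleteSpace H]
    (L0 : H →ₗ.[ℂ] H)
    (hdense : Dense (L0.domain : Set H))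
    (hclosed : L0.IsClosed)
    (hsym : ∀ u v : L0.domain, ⟪L0 u, (v : H)⟫ = ⟪(u : H), L0 v⟫)
    (κ : ℝ) (hκ : 0 < κ)
    (hpos : ∀ y : L0.domain, κ * ‖(y : H)‖ ^ 2 ≤ (⟪L0 y, (y : H)⟫).re)
    -- `L` is a self-adjoint extension of `L0`, positive definite, bijective onto `H`
    (L : H →ₗ.[ℂ] H) (hL0L : L0 ≤ L) (hLsa : L.adjoint = L)
    (hLpos : ∀ y : L.domain, κ * ‖(y : H)‖ ^ 2 ≤ (⟪L y, (y : H)⟫).re)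
    -- `Linv` is the (bounded, everywhere-defined, self-adjoint) inverse of `L`
    (Linv : H →L[ℂ] H) (hLinvsa : IsSelfAdjoint Linv)
    (hinvl : ∀ x : L.domain, Linv (L x) = (x : H))
    (hinvmem : ∀ x : H, Linv x ∈ L.domain)
    (hinvr : ∀ x : H, L ⟨Linv x, hinvmem x⟩ = x)
    -- `D` is a closed subspace of `H` with `D ⊆ (Ker L0*)ᗮ` and `L⁻¹ D ⊆ D`
    (D : Submodule ℂ H) (hDclosed : IsClosed (D : Set H))
    (hDK : D ≤ (pker L0.adjoint)ᗮ)
    (hDinv : ∀ x ∈ D, Linv x ∈ D) :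
    ∀ d ∈ D, ∃ h : Linv d ∈ L0.domain, L0 ⟨Linv d, h⟩ = d := by
  intro d hd
  have hS : ∀ u : L0.domain, Linv (L0 u) = u := fun u => by
    rw [hL0L.2 (y := ⟨u, hL0L.1 u.2⟩) rfl, hinvl]
  obtain ⟨u, hu, hud⟩ := (LinearPMap.mem_graph_iff L0).mp
    (mk_mem_graph_of_mem_pker_adjoint_orthogonal hdense hclosed Linv hS (hDK hd))
  have hu' : (u : H) = Linv d := hu
  have h : Linv d ∈ L0.domain := hu' ▸ u.2
  refine ⟨h, ?_⟩
  rwa [show (⟨Linv d, h⟩ : L0.domain) = u from Subtype.ext hu'.symm]
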